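/- arXiv:2308.05519 — 2 statements merged into one kernel-verified Lean document; each statement's English description precedes it below -/
import Mathlib

section
/- For every R ≥ 0, Σ_{j=1}^{∞} P(j, R²) · Q(j, R²) = R² e^{-2R²} ( I₀(2R²) + I₁(2R²) ). (This is the number variance of the infinite complex Ginibre ensemble in a centred disc of radius R.) -/
open MeasureTheory Real Filter

/-- The lower incomplete gamma function `γ(n,x) = ∫₀^x t^(n-1) e^(-t) dt`. -/
noncomputable def lowGamma (n x : ℝ) : ℝ := ∫ t in (0:ℝ)..x, t ^ (n - 1) * Real.exp (-t)

/-- The regularized lower incomplete gamma function `P(n,x) = γ(n,x)/Γ(n)`. -/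
noncomputable def regP (n x : ℝ) : ℝ := (Real.Gamma n)⁻¹ * lowGamma n x

/-- The regularized upper incomplete gamma function `Q(n,x) = 1 - P(n,x)`. -/
noncomputable def regQ (n x : ℝ) : ℝ := 1 - regP n x

/-- The modified Bessel function of the first kind of order `ν ∈ {0,1}`:
`I_ν(z) = Σ_{k=0}^∞ (z/2)^(2k+ν) / (k! (k+ν)!)`. -/
noncomputable def besselI (ν : ℕ) (z : ℝ) : ℝ :=
  ∑' k : ℕ, (z / 2) ^ (2 * k + ν) / (Nat.factorial k * Nat.factorial (k + ν))

/-- The mass at `k` of the Poisson law with parameter `x`. -/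
noncomputable def poissonMass (x : ℝ) (k : ℕ) : ℝ := Real.exp (-x) * (x ^ k / Nat.factorial k)

/-- The mass of `{0, …, n - 1}` under the Poisson law with parameter `x`. -/
noncomputable def poissonCumul (x : ℝ) (n : ℕ) : ℝ := ∑ k ∈ Finset.range n, poissonMass x k

lemma poissonMass_nonneg {x : ℝ} (hx : 0 ≤ x) (k : ℕ) : 0 ≤ poissonMass x k := by
  unfold poissonMass; positivity

lemma poissonCumul_succ (x : ℝ) (n : ℕ) :
    poissonCumul x (n + 1) = poissonCumul x n + poissonMass x n :=
  Finset.sum_range_succ _ _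

lemma succ_mul_poissonMass_succ (x : ℝ) (k : ℕ) :
    ((k : ℝ) + 1) * poissonMass x (k + 1) = x * poissonMass x k := by
  unfold poissonMass
  rw [Nat.factorial_succ]
  push_cast
  field_simp
  ring

lemma hasSum_poissonMass (x : ℝ) : HasSum (poissonMass x) 1 := by
  have h : HasSum (fun k : ℕ => x ^ k / (Nat.factorial k : ℝ)) (Real.exp x) := by
    rw [Real.exp_eq_exp_ℝ]
    exact NormedSpace.expSeries_div_hasSum_exp x
  have h' := h.mul_left (Real.exp (-x))
  rwa [← Real.exp_add, neg_add_cancel, Real.exp_zero] at h'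

lemma hasSum_poissonMass_add (x : ℝ) (n : ℕ) :
    HasSum (fun k => poissonMass x (k + n)) (1 - poissonCumul x n) :=
  (hasSum_nat_add_iff' n).2 (hasSum_poissonMass x)

lemma poissonCumul_nonneg {x : ℝ} (hx : 0 ≤ x) (n : ℕ) : 0 ≤ poissonCumul x n :=
  Finset.sum_nonneg fun k _ => poissonMass_nonneg hx k

lemma poissonCumul_le_one {x : ℝ} (hx : 0 ≤ x) (n : ℕ) : poissonCumul x n ≤ 1 :=
  sub_nonneg.1 ((hasSum_poissonMass_add x n).nonneg fun k => poissonMass_nonneg hx (k + n))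

lemma poissonMass_le_one {x : ℝ} (hx : 0 ≤ x) (n : ℕ) : poissonMass x n ≤ 1 :=
  le_hasSum (hasSum_poissonMass x) n fun k _ => poissonMass_nonneg hx k

lemma tendsto_poissonCumul (x : ℝ) : Tendsto (poissonCumul x) atTop (nhds 1) :=
  (hasSum_poissonMass x).tendsto_sum_nat

/-- Markov-type bound for the Poisson tails. -/
lemma succ_mul_one_sub_poissonCumul_succ_le {x : ℝ} (hx : 0 ≤ x) (n : ℕ) :
    ((n : ℝ) + 1) * (1 - poissonCumul x (n + 1)) ≤ x * (1 - poissonCumul x n) := by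
  refine hasSum_le (fun k => ?_) ((hasSum_poissonMass_add x (n + 1)).mul_left ((n : ℝ) + 1))
    ((hasSum_poissonMass_add x n).mul_left x)
  rw [← succ_mul_poissonMass_succ, ← add_assoc]
  refine mul_le_mul_of_nonneg_right ?_ (poissonMass_nonneg hx _)
  push_cast
  linarith [Nat.cast_nonneg (α := ℝ) k]

lemma hasDerivAt_poissonCumul_succ (n : ℕ) (x : ℝ) :
    HasDerivAt (fun t => poissonCumul t (n + 1)) (-poissonMass x n) x := by
  have hexp : HasDerivAt (fun t : ℝ => Real.exp (-t)) (-Real.exp (-x)) x := by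
    simpa using (hasDerivAt_neg x).exp
  induction n with
  | zero => simpa [poissonCumul, poissonMass] using hexp
  | succ n ih =>
    have hmass : HasDerivAt (fun t => poissonMass t (n + 1))
        (poissonMass x n - poissonMass x (n + 1)) x := by
      have h := hexp.mul ((hasDerivAt_pow (n + 1) x).div_const (Nat.factorial (n + 1) : ℝ))
      refine h.congr_deriv ?_
      unfold poissonMass
      rw [Nat.factorial_succ]
      push_cast
      field_simp
      ring
    have h := ih.add hmass
    refine (h.congr_deriv (by ring)).congr_of_eventuallyEq (Eventually.of_forall fun t => ?_)
    exact poissonCumul_succ t (n + 1)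

lemma poissonCumul_zero_succ (n : ℕ) : poissonCumul 0 (n + 1) = 1 := by
  unfold poissonCumul poissonMass
  rw [Finset.sum_range_succ']
  simp

/-- The Poisson–gamma relation for integer shape parameters. -/
lemma regP_natCast_add_one (n : ℕ) (x : ℝ) :
    regP ((n : ℝ) + 1) x = 1 - poissonCumul x (n + 1) := by
  have hmass : ∫ t in (0:ℝ)..x, poissonMass t n = 1 - poissonCumul x (n + 1) := by
    have hcont : Continuous fun t : ℝ => poissonMass t n := by
      unfold poissonMass; fun_prop
    have h := intervalIntegral.integral_eq_sub_of_hasDerivAt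
      (fun t _ => (hasDerivAt_poissonCumul_succ n t).neg)
      (by simpa using hcont.intervalIntegrable 0 x)
    simp only [neg_neg, Pi.neg_apply, poissonCumul_zero_succ] at h
    rw [h]
    ring
  rw [← hmass, regP, lowGamma, Real.Gamma_nat_eq_factorial, ← intervalIntegral.integral_const_mul]
  refine intervalIntegral.integral_congr fun t _ => ?_
  simp only [poissonMass, add_sub_cancel_right, Real.rpow_natCast]
  ring

lemma sum_poissonCumul_mul_one_sub (x : ℝ) (n : ℕ) :
    ∑ j ∈ Finset.range (n + 1), (1 - poissonCumul x (j + 1)) * poissonCumul x (j + 1)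
      = ((n : ℝ) + 1) * (1 - poissonCumul x (n + 1)) * poissonCumul x (n + 1)
        - x * ((1 - poissonCumul x n) * poissonCumul x n)
        + x * ∑ j ∈ Finset.range n,
          (poissonMass x j * poissonMass x j + poissonMass x j * poissonMass x (j + 1)) := by
  induction n with
  | zero => simp [poissonCumul]
  | succ n ih =>
    rw [Finset.sum_range_succ, ih, Finset.sum_range_succ _ n, poissonCumul_succ x (n + 1),
      poissonCumul_succ x n]
    push_cast
    linear_combination (-(1 - 2 * poissonCumul x n - 2 * poissonMass x n - poissonMass x (n + 1)))
      * succ_mul_poissonMass_succ x n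

lemma hasSum_besselI_poisson {x : ℝ} (hx : 0 ≤ x) (ν : ℕ) :
    HasSum (fun k => poissonMass x k * poissonMass x (k + ν))
      (Real.exp (-2 * x) * besselI ν (2 * x)) := by
  have hsum : Summable fun k => poissonMass x k * poissonMass x (k + ν) :=
    (hasSum_poissonMass x).summable.of_nonneg_of_le
      (fun k => mul_nonneg (poissonMass_nonneg hx _) (poissonMass_nonneg hx _))
      (fun k => mul_le_of_le_one_right (poissonMass_nonneg hx _) (poissonMass_le_one hx _))
  convert hsum.hasSum using 1
  rw [besselI, ← tsum_mul_left]
  refine tsum_congr fun k => ?_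
  have hexp : Real.exp (-2 * x) = Real.exp (-x) * Real.exp (-x) := by
    rw [← Real.exp_add]; ring_nf
  rw [hexp, poissonMass, poissonMass, mul_div_cancel_left₀ x two_ne_zero]
  field_simp
  ring

theorem number_variance_GinUE_origin (R : ℝ) (hR : 0 ≤ R) :
    ∑' j : ℕ, regP (j + 1) (R ^ 2) * regQ (j + 1) (R ^ 2)
      = R ^ 2 * Real.exp (-2 * R ^ 2) * (besselI 0 (2 * R ^ 2) + besselI 1 (2 * R ^ 2)) := by
  have hx : 0 ≤ R ^ 2 := sq_nonneg R
  generalize R ^ 2 = x at hx ⊢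
  simp_rw [regQ, regP_natCast_add_one, sub_sub_cancel]
  refine HasSum.tsum_eq ?_
  rw [hasSum_iff_tendsto_nat_of_nonneg fun j => mul_nonneg
    (sub_nonneg.2 (poissonCumul_le_one hx _)) (poissonCumul_nonneg hx _)]
  rw [← tendsto_add_atTop_iff_nat 1]
  simp_rw [sum_poissonCumul_mul_one_sub]
  have hC := tendsto_poissonCumul x
  have hT : Tendsto (fun n => x * (1 - poissonCumul x n)) atTop (nhds 0) := by
    simpa using (hC.const_sub 1).const_mul x
  have hnT : Tendsto (fun n : ℕ => ((n : ℝ) + 1) * (1 - poissonCumul x (n + 1)))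
      atTop (nhds 0) :=
    squeeze_zero (fun n => mul_nonneg (by positivity) (sub_nonneg.2 (poissonCumul_le_one hx _)))
      (succ_mul_one_sub_poissonCumul_succ_le hx) hT
  have hS := (((hasSum_besselI_poisson hx 0).add
    (hasSum_besselI_poisson hx 1)).tendsto_sum_nat).const_mul x
  have h := ((hnT.mul (hC.comp (tendsto_add_atTop_nat 1))).sub (hT.mul hC)).add hS
  convert h using 2
  · simp only [Function.comp_apply, add_zero]
    ring
  · ring
end

section
/- The function V(R) := Σ_{j=1}^{∞} P(j, R²) · Q(j, R²) satisfies lim_{R→∞} V(R)/R = 1/√π and lim_{R→0⁺} V(R)/R² = 1. (These are the large- and small-radius asymptotics of the number variance of the infinite complex Ginibre ensemble.) -/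
open MeasureTheory Real Filter

/-- The number variance of the infinite complex Ginibre ensemble in a centred disc
of radius `R`: `V(R) = Σ_{j=1}^∞ P(j,R²) Q(j,R²)`. -/
noncomputable def varGinUE (R : ℝ) : ℝ :=
  ∑' j : ℕ, regP (j + 1) (R ^ 2) * regQ (j + 1) (R ^ 2)

/-- The probability of the value `j` under the Poisson law of mean `t`. -/
noncomputable def poissonWeight (j : ℕ) (t : ℝ) : ℝ := Real.exp (-t) * t ^ j / j.factorial

lemma poissonWeight_nonneg (j : ℕ) {t : ℝ} (ht : 0 ≤ t) : 0 ≤ poissonWeight j t := by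
  unfold poissonWeight; positivity

lemma hasSum_poissonWeight (t : ℝ) : HasSum (fun j => poissonWeight j t) 1 := by
  have h := (NormedSpace.expSeries_div_hasSum_exp (𝔸 := ℝ) t).mul_left (Real.exp (-t))
  rw [← Real.exp_eq_exp_ℝ, ← Real.exp_add, neg_add_cancel, Real.exp_zero] at h
  simpa [poissonWeight, mul_div_assoc] using h

lemma sum_poissonWeight_le_one (n : ℕ) {t : ℝ} (ht : 0 ≤ t) :
    ∑ k ∈ Finset.range n, poissonWeight k t ≤ 1 :=
  sum_le_hasSum _ (fun k _ => poissonWeight_nonneg k ht) (hasSum_poissonWeight t)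

lemma poissonWeight_le_one (j : ℕ) {t : ℝ} (ht : 0 ≤ t) : poissonWeight j t ≤ 1 :=
  le_hasSum (hasSum_poissonWeight t) j (fun k _ => poissonWeight_nonneg k ht)

@[fun_prop]
lemma continuous_poissonWeight (j : ℕ) : Continuous (poissonWeight j) := by
  unfold poissonWeight; fun_prop

lemma hasDerivAt_poissonWeight_succ (j : ℕ) (t : ℝ) :
    HasDerivAt (poissonWeight (j + 1)) (poissonWeight j t - poissonWeight (j + 1) t) t := by
  unfold poissonWeight
  have h := (((hasDerivAt_neg t).exp).fun_mul (hasDerivAt_pow (j + 1) t)).div_const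
    ((j + 1).factorial : ℝ)
  refine h.congr_deriv ?_
  push_cast [Nat.factorial_succ]
  have := Nat.factorial_ne_zero j
  field_simp
  ring

lemma hasDerivAt_sum_poissonWeight (j : ℕ) (t : ℝ) :
    HasDerivAt (fun t => ∑ k ∈ Finset.range (j + 1), poissonWeight k t)
      (-poissonWeight j t) t := by
  induction j with
  | zero =>
    simpa [poissonWeight] using (hasDerivAt_neg t).exp
  | succ j ih =>
    have hs (f : ℕ → ℝ) := Finset.sum_range_succ f (j + 1)
    simp_rw [hs]
    refine (ih.fun_add (hasDerivAt_poissonWeight_succ j t)).congr_deriv ?_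
    ring

lemma sum_poissonWeight_zero (j : ℕ) :
    ∑ k ∈ Finset.range (j + 1), poissonWeight k 0 = 1 := by
  simp [Finset.sum_range_succ', poissonWeight]

lemma regP_nat_succ (j : ℕ) (x : ℝ) :
    regP (j + 1) x = 1 - ∑ k ∈ Finset.range (j + 1), poissonWeight k x := by
  have h := intervalIntegral.integral_eq_sub_of_hasDerivAt (a := 0) (b := x)
    (fun t _ => hasDerivAt_sum_poissonWeight j t)
    ((continuous_poissonWeight j).neg.intervalIntegrable _ _)
  rw [sum_poissonWeight_zero, intervalIntegral.integral_neg] at h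
  have h2 : regP (j + 1) x = ∫ t in (0:ℝ)..x, poissonWeight j t := by
    rw [regP, lowGamma, Real.Gamma_nat_eq_factorial, ← intervalIntegral.integral_const_mul]
    congr 1
    ext t
    rw [add_sub_cancel_right, Real.rpow_natCast, poissonWeight]
    ring
  linarith

lemma hasDerivAt_sum_mul_one_sub (n : ℕ) (t : ℝ) :
    HasDerivAt (fun t => ∑ j ∈ Finset.range n,
        (1 - ∑ k ∈ Finset.range (j + 1), poissonWeight k t) *
          ∑ k ∈ Finset.range (j + 1), poissonWeight k t)
      (∑ j ∈ Finset.range n, poissonWeight j t ^ 2 -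
        (∑ k ∈ Finset.range n, poissonWeight k t) *
          (1 - ∑ k ∈ Finset.range n, poissonWeight k t)) t := by
  induction n with
  | zero => simpa using hasDerivAt_const t (0 : ℝ)
  | succ n ih =>
    have h := hasDerivAt_sum_poissonWeight n t
    have hs (f : ℕ → ℝ) := Finset.sum_range_succ f n
    have hf (t : ℝ) := hs fun j => (1 - ∑ k ∈ Finset.range (j + 1), poissonWeight k t) *
      ∑ k ∈ Finset.range (j + 1), poissonWeight k t
    simp_rw [hf]
    refine (ih.fun_add ((h.const_sub 1).fun_mul h)).congr_deriv ?_
    simp_rw [hs]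
    ring

lemma integral_cos_pow_odd (k : ℕ) : ∫ θ in (0:ℝ)..π, Real.cos θ ^ (2 * k + 1) = 0 := by
  induction k with
  | zero => simp
  | succ k ih =>
    rw [show 2 * (k + 1) + 1 = 2 * k + 1 + 2 by ring, integral_cos_pow, ih]
    simp

lemma integral_cos_pow_even (k : ℕ) :
    ∫ θ in (0:ℝ)..π, Real.cos θ ^ (2 * k) =
      π * (2 * k).factorial / (4 ^ k * (k.factorial : ℝ) ^ 2) := by
  induction k with
  | zero => simp
  | succ k ih =>
    rw [show 2 * (k + 1) = 2 * k + 2 by ring, integral_cos_pow, ih]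
    have := Nat.factorial_ne_zero k
    push_cast [Nat.factorial_succ]
    simp only [Real.sin_pi, Real.sin_zero]
    field_simp
    ring

/-- The function `exp (-2t) I₀(2t)`, given by the integral representation of the Bessel
function `I₀`. -/
noncomputable def scaledBessel (t : ℝ) : ℝ :=
  π⁻¹ * ∫ θ in (0:ℝ)..π, Real.exp (-(2 * t * (1 - Real.cos θ)))

@[fun_prop]
lemma continuous_scaledBessel : Continuous scaledBessel := by
  unfold scaledBessel
  refine continuous_const.mul ?_
  apply intervalIntegral.continuous_parametric_intervalIntegral_of_continuous'
  fun_prop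

lemma scaledBessel_zero : scaledBessel 0 = 1 := by
  simp [scaledBessel, Real.pi_ne_zero]

lemma scaledBessel_nonneg (t : ℝ) : 0 ≤ scaledBessel t :=
  mul_nonneg (by positivity)
    (intervalIntegral.integral_nonneg Real.pi_pos.le fun _ _ => (Real.exp_pos _).le)

lemma hasSum_integral_exp_mul_cos (s : ℝ) :
    HasSum (fun n : ℕ => s ^ n / n.factorial * ∫ θ in (0:ℝ)..π, Real.cos θ ^ n)
      (∫ θ in (0:ℝ)..π, Real.exp (s * Real.cos θ)) := by
  simp_rw [← intervalIntegral.integral_const_mul]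
  apply intervalIntegral.hasSum_integral_of_dominated_convergence
    (bound := fun n _ => |s| ^ n / n.factorial)
  · intro n
    exact Continuous.aestronglyMeasurable (by fun_prop)
  · intro n
    filter_upwards with θ _
    rw [norm_mul, norm_div, norm_pow, norm_pow, Real.norm_natCast, Real.norm_eq_abs]
    exact mul_le_of_le_one_right (by positivity)
      (pow_le_one₀ (norm_nonneg _) (Real.abs_cos_le_one θ))
  · filter_upwards with θ _
    exact Real.summable_pow_div_factorial |s|
  · exact intervalIntegrable_const
  · filter_upwards with θ _
    have h := NormedSpace.expSeries_div_hasSum_exp (𝔸 := ℝ) (s * Real.cos θ)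
    rw [← Real.exp_eq_exp_ℝ] at h
    simpa [mul_pow, div_mul_eq_mul_div] using h

lemma hasSum_poissonWeight_sq {t : ℝ} (ht : 0 ≤ t) :
    HasSum (fun j => poissonWeight j t ^ 2) (scaledBessel t) := by
  have hs : Summable (fun j => poissonWeight j t ^ 2) :=
    Summable.of_nonneg_of_le (fun j => sq_nonneg _)
      (fun j => pow_le_of_le_one (poissonWeight_nonneg j ht) (poissonWeight_le_one j ht) two_ne_zero)
      (hasSum_poissonWeight t).summable
  have hI := (hasSum_integral_exp_mul_cos (2 * t)).mul_left (π⁻¹ * Real.exp (-(2 * t)))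
  have hB : scaledBessel t = π⁻¹ * Real.exp (-(2 * t)) *
      ∫ θ in (0:ℝ)..π, Real.exp (2 * t * Real.cos θ) := by
    rw [scaledBessel, mul_assoc, ← intervalIntegral.integral_const_mul (Real.exp _)]
    congr 2 with θ
    rw [← Real.exp_add]
    ring_nf
  have he : HasSum (fun k : ℕ => π⁻¹ * Real.exp (-(2 * t)) *
      ((2 * t) ^ (2 * k) / (2 * k).factorial * ∫ θ in (0:ℝ)..π, Real.cos θ ^ (2 * k)))
      (∑' j, poissonWeight j t ^ 2) := by
    convert hs.hasSum using 2 with k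
    have h1 := Nat.factorial_ne_zero k
    have h2 := Nat.factorial_ne_zero (2 * k)
    have h3 := Real.pi_ne_zero
    rw [integral_cos_pow_even, poissonWeight, show -(2 * t) = -t + -t by ring, Real.exp_add,
      mul_pow, pow_mul 2 2 k, show (2:ℝ) ^ 2 = 4 by norm_num]
    field_simp
    ring
  have ho : HasSum (fun k : ℕ => π⁻¹ * Real.exp (-(2 * t)) *
      ((2 * t) ^ (2 * k + 1) / (2 * k + 1).factorial *
        ∫ θ in (0:ℝ)..π, Real.cos θ ^ (2 * k + 1))) 0 := by
    simp [integral_cos_pow_odd]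
  have h := hI.unique (he.even_add_odd ho)
  rw [hB, h, add_zero]
  exact hs.hasSum

lemma hasSum_regP_mul_regQ {x : ℝ} (hx : 0 ≤ x) :
    HasSum (fun j : ℕ => regP (j + 1) x * regQ (j + 1) x)
      (∫ t in (0:ℝ)..x, scaledBessel t) := by
  simp_rw [regQ, regP_nat_succ, sub_sub_cancel]
  rw [hasSum_iff_tendsto_nat_of_nonneg]
  swap
  · intro j
    exact mul_nonneg (sub_nonneg.2 (sum_poissonWeight_le_one _ hx))
      (Finset.sum_nonneg fun k _ => poissonWeight_nonneg k hx)
  have key (n : ℕ) := intervalIntegral.integral_eq_sub_of_hasDerivAt (a := 0) (b := x)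
    (fun t _ => hasDerivAt_sum_mul_one_sub n t)
    (Continuous.intervalIntegrable (by fun_prop) _ _)
  simp only [sum_poissonWeight_zero, sub_self, zero_mul, Finset.sum_const_zero, sub_zero] at key
  simp_rw [← key]
  apply intervalIntegral.tendsto_integral_filter_of_dominated_convergence (fun _ => 1)
  · filter_upwards with n
    exact Continuous.aestronglyMeasurable (by fun_prop)
  · filter_upwards with n
    filter_upwards with t ht
    rw [Set.uIoc_of_le hx] at ht
    have h0 := sum_poissonWeight_le_one n ht.1.le
    have h1 : 0 ≤ ∑ k ∈ Finset.range n, poissonWeight k t :=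
      Finset.sum_nonneg fun k _ => poissonWeight_nonneg k ht.1.le
    have h2 : 0 ≤ ∑ k ∈ Finset.range n, poissonWeight k t ^ 2 :=
      Finset.sum_nonneg fun k _ => sq_nonneg _
    have h3 : ∑ k ∈ Finset.range n, poissonWeight k t ^ 2 ≤
        ∑ k ∈ Finset.range n, poissonWeight k t :=
      Finset.sum_le_sum fun k _ => pow_le_of_le_one (poissonWeight_nonneg k ht.1.le)
        (poissonWeight_le_one k ht.1.le) two_ne_zero
    rw [Real.norm_eq_abs, abs_le]
    constructor <;> nlinarith
  · exact intervalIntegrable_const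
  · filter_upwards with t ht
    rw [Set.uIoc_of_le hx] at ht
    have h1 := (hasSum_poissonWeight t).tendsto_sum_nat
    have h2 := (hasSum_poissonWeight_sq ht.1.le).tendsto_sum_nat
    simpa using h2.sub (h1.mul (h1.const_sub 1))

lemma varGinUE_eq_integral (R : ℝ) :
    varGinUE R = ∫ t in (0:ℝ)..R ^ 2, scaledBessel t :=
  (hasSum_regP_mul_regQ (sq_nonneg R)).tsum_eq

lemma mul_scaledBessel_sq {r : ℝ} (hr : 0 < r) :
    r * scaledBessel (r ^ 2) = π⁻¹ * ∫ u in Set.Ioi (0:ℝ),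
      (Set.Ioc 0 (π * r)).indicator
        (fun u => Real.exp (-(2 * r ^ 2 * (1 - Real.cos (u / r))))) u := by
  rw [integral_indicator measurableSet_Ioc, Measure.restrict_restrict measurableSet_Ioc,
    Set.inter_eq_left.2 Set.Ioc_subset_Ioi_self,
    ← intervalIntegral.integral_of_le (by positivity), scaledBessel,
    intervalIntegral.integral_comp_div (fun θ => Real.exp (-(2 * r ^ 2 * (1 - Real.cos θ)))) hr.ne',
    zero_div, mul_div_cancel_right₀ _ hr.ne', smul_eq_mul]
  ring

lemma norm_indicator_exp_cos_le {r : ℝ} (hr : 0 < r) (u : ℝ) :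
    ‖(Set.Ioc 0 (π * r)).indicator
        (fun u => Real.exp (-(2 * r ^ 2 * (1 - Real.cos (u / r))))) u‖ ≤
      Real.exp (-(4 / π ^ 2) * u ^ 2) := by
  by_cases hu : u ∈ Set.Ioc 0 (π * r)
  · rw [Set.indicator_of_mem hu, Real.norm_eq_abs, Real.abs_exp, Real.exp_le_exp]
    have h := Real.cos_le_one_sub_mul_cos_sq (x := u / r) (by
      rw [abs_of_pos (div_pos hu.1 hr), div_le_iff₀ hr]
      exact hu.2)
    have h2 : 2 * r ^ 2 * (2 / π ^ 2 * (u / r) ^ 2) = 4 / π ^ 2 * u ^ 2 := by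
      field_simp
      ring
    have h3 := mul_le_mul_of_nonneg_left h (by positivity : 0 ≤ 2 * r ^ 2)
    linarith
  · rw [Set.indicator_of_notMem hu, norm_zero]
    positivity

lemma two_mul_sq_mul_one_sub_cos_div {r : ℝ} (hr : r ≠ 0) (u : ℝ) :
    2 * r ^ 2 * (1 - Real.cos (u / r)) = u ^ 2 * Real.sinc (u / 2 / r) ^ 2 := by
  rcases eq_or_ne u 0 with rfl | hu
  · simp
  · rw [Real.sinc_of_ne_zero (by positivity), show u / r = 2 * (u / 2 / r) by ring,
      Real.cos_two_mul, Real.cos_sq']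
    field_simp
    ring

lemma tendsto_exp_cos_div (u : ℝ) :
    Tendsto (fun r : ℝ => Real.exp (-(2 * r ^ 2 * (1 - Real.cos (u / r))))) atTop
      (nhds (Real.exp (-1 * u ^ 2))) := by
  have h : Tendsto (fun r : ℝ => Real.sinc (u / 2 / r)) atTop (nhds 1) := by
    rw [← Real.sinc_zero]
    exact (Real.continuous_sinc.tendsto 0).comp (tendsto_const_nhds.div_atTop tendsto_id)
  have h2 := (((h.pow 2).const_mul (u ^ 2)).neg).rexp
  rw [one_pow, mul_one, neg_eq_neg_one_mul] at h2
  refine h2.congr' ?_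
  filter_upwards [eventually_ne_atTop 0] with r hr
  rw [two_mul_sq_mul_one_sub_cos_div hr]

lemma tendsto_mul_scaledBessel_sq :
    Tendsto (fun r : ℝ => r * scaledBessel (r ^ 2)) atTop (nhds (1 / (2 * √π))) := by
  have h : Tendsto (fun r : ℝ => ∫ u in Set.Ioi (0:ℝ),
      (Set.Ioc 0 (π * r)).indicator
        (fun u => Real.exp (-(2 * r ^ 2 * (1 - Real.cos (u / r))))) u) atTop
      (nhds (∫ u in Set.Ioi (0:ℝ), Real.exp (-1 * u ^ 2))) := by
    apply tendsto_integral_filter_of_dominated_convergence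
      (fun u => Real.exp (-(4 / π ^ 2) * u ^ 2))
    · filter_upwards with r
      exact (Continuous.aestronglyMeasurable (by fun_prop)).indicator measurableSet_Ioc
    · filter_upwards [eventually_gt_atTop 0] with r hr
      filter_upwards with u
      exact norm_indicator_exp_cos_le hr u
    · exact (integrable_exp_neg_mul_sq (by positivity)).integrableOn
    · filter_upwards [ae_restrict_mem measurableSet_Ioi] with u hu
      refine (tendsto_exp_cos_div u).congr' ?_
      filter_upwards [eventually_ge_atTop (u / π)] with r hr
      rw [Set.indicator_of_mem]
      exact ⟨hu, (div_le_iff₀' Real.pi_pos).1 hr⟩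
  rw [integral_gaussian_Ioi] at h
  have h2 := h.const_mul π⁻¹
  have e : π⁻¹ * (√(π / 1) / 2) = 1 / (2 * √π) := by
    have := Real.sq_sqrt Real.pi_pos.le
    have h3 : √π ≠ 0 := by positivity
    rw [div_one]
    field_simp
    linarith
  rw [e] at h2
  refine h2.congr' ?_
  filter_upwards [eventually_gt_atTop 0] with r hr
  rw [mul_scaledBessel_sq hr]

lemma exists_mul_scaledBessel_sq_le :
    ∃ C, ∀ r : ℝ, 0 < r → r * scaledBessel (r ^ 2) ≤ C := by
  refine ⟨π⁻¹ * ∫ u in Set.Ioi (0:ℝ), Real.exp (-(4 / π ^ 2) * u ^ 2), fun r hr => ?_⟩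
  rw [mul_scaledBessel_sq hr]
  refine mul_le_mul_of_nonneg_left ?_ (by positivity)
  refine (Real.le_norm_self _).trans (norm_integral_le_of_norm_le ?_ ?_)
  · exact (integrable_exp_neg_mul_sq (by positivity)).integrableOn
  · filter_upwards with u
    exact norm_indicator_exp_cos_le hr u

lemma integral_scaledBessel_sq_div {R : ℝ} (hR : 0 < R) :
    (∫ t in (0:ℝ)..R ^ 2, scaledBessel t) / R =
      ∫ s in (0:ℝ)..1, R * scaledBessel (s * R ^ 2) := by
  have h := intervalIntegral.mul_integral_comp_mul_right (a := 0) (b := 1)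
    (f := scaledBessel) (R ^ 2)
  rw [zero_mul, one_mul] at h
  rw [← h, intervalIntegral.integral_const_mul]
  field_simp

lemma mul_scaledBessel_mul_sq {R s : ℝ} (hs : 0 < s) :
    R * scaledBessel (s * R ^ 2) =
      s ^ (-(1 / 2) : ℝ) * (√s * R * scaledBessel ((√s * R) ^ 2)) := by
  rw [mul_pow, Real.sq_sqrt hs.le, Real.rpow_neg hs.le, ← Real.sqrt_eq_rpow]
  have : √s ≠ 0 := by positivity
  field_simp

lemma tendsto_integral_scaledBessel_div_atTop :
    Tendsto (fun R : ℝ => (∫ t in (0:ℝ)..R ^ 2, scaledBessel t) / R) atTop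
      (nhds (1 / √π)) := by
  obtain ⟨C, hC⟩ := exists_mul_scaledBessel_sq_le
  have hi : IntervalIntegrable (fun s : ℝ => s ^ (-(1 / 2) : ℝ)) volume 0 1 :=
    intervalIntegral.intervalIntegrable_rpow' (by norm_num)
  have h : Tendsto (fun R : ℝ => ∫ s in (0:ℝ)..1, R * scaledBessel (s * R ^ 2)) atTop
      (nhds (∫ s in (0:ℝ)..1, s ^ (-(1 / 2) : ℝ) * (1 / (2 * √π)))) := by
    apply intervalIntegral.tendsto_integral_filter_of_dominated_convergence
      (fun s => s ^ (-(1 / 2) : ℝ) * C)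
    · filter_upwards with R
      exact Continuous.aestronglyMeasurable (by fun_prop)
    · filter_upwards [eventually_gt_atTop 0] with R hR
      filter_upwards with s hs
      rw [Set.uIoc_of_le zero_le_one] at hs
      rw [Real.norm_of_nonneg (mul_nonneg hR.le (scaledBessel_nonneg _)),
        mul_scaledBessel_mul_sq hs.1]
      gcongr
      · exact Real.rpow_nonneg hs.1.le _
      · exact hC _ (mul_pos (Real.sqrt_pos.2 hs.1) hR)
    · exact hi.mul_const C
    · filter_upwards with s hs
      rw [Set.uIoc_of_le zero_le_one] at hs
      simp_rw [mul_scaledBessel_mul_sq hs.1]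
      exact (tendsto_mul_scaledBessel_sq.comp
        (tendsto_id.const_mul_atTop (Real.sqrt_pos.2 hs.1))).const_mul _
  have e : ∫ s in (0:ℝ)..1, s ^ (-(1 / 2) : ℝ) * (1 / (2 * √π)) = 1 / √π := by
    rw [intervalIntegral.integral_mul_const, integral_rpow (Or.inl (by norm_num))]
    norm_num
    field_simp
  rw [e] at h
  refine h.congr' ?_
  filter_upwards [eventually_gt_atTop 0] with R hR
  rw [integral_scaledBessel_sq_div hR]

lemma tendsto_integral_scaledBessel_div_nhdsNE :
    Tendsto (fun x : ℝ => (∫ t in (0:ℝ)..x, scaledBessel t) / x) (nhdsWithin 0 {0}ᶜ)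
      (nhds 1) := by
  have h := (continuous_scaledBessel.integral_hasStrictDerivAt 0 0).hasDerivAt
  rw [hasDerivAt_iff_tendsto_slope_zero, scaledBessel_zero] at h
  simpa [div_eq_inv_mul] using h

theorem number_variance_GinUE_asymptotics :
    Tendsto (fun R : ℝ => varGinUE R / R) atTop (nhds (1 / Real.sqrt π)) ∧
    Tendsto (fun R : ℝ => varGinUE R / R ^ 2) (nhdsWithin 0 (Set.Ioi 0)) (nhds 1) := by
  simp_rw [varGinUE_eq_integral]
  refine ⟨tendsto_integral_scaledBessel_div_atTop,
    tendsto_integral_scaledBessel_div_nhdsNE.comp (tendsto_nhdsWithin_iff.2 ⟨?_, ?_⟩)⟩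
  · exact ((continuous_pow 2).tendsto' (0 : ℝ) 0 (by simp)).mono_left nhdsWithin_le_nhds
  · filter_upwards [self_mem_nhdsWithin] with R hR
    exact pow_ne_zero 2 (ne_of_gt hR)
end
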